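/- arXiv:1901.06362 — 14 statements merged into one kernel-verified Lean document; each statement's English description precedes it below -/
import Mathlib

section
/- Let R₁ and R₂ be (possibly non-unital, possibly non-commutative) rings and let I be a two-sided ideal of the direct product R₁ × R₂. Then I is directly decomposable if and only if for all a ∈ R₁ and b ∈ R₂, (a,b) ∈ I implies (a,0) ∈ I and (0,b) ∈ I. -/
open Pointwise

/-- A two-sided ideal `I` of a direct product `R₁ × R₂` is *directly decomposable* if it is
the product of a two-sided ideal of `R₁` and a two-sided ideal of `R₂`. -/
def IsDirectlyDecomposable {R₁ R₂ : Type*} [NonUnitalNonAssocRing R₁] [NonUnitalNonAssocRing R₂]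
    (I : TwoSidedIdeal (R₁ × R₂)) : Prop :=
  ∃ (I₁ : TwoSidedIdeal R₁) (I₂ : TwoSidedIdeal R₂),
    ∀ p : R₁ × R₂, p ∈ I ↔ p.1 ∈ I₁ ∧ p.2 ∈ I₂

/-- The two-sided ideal of `R₁` consisting of all `a` with `(a, 0) ∈ I`. -/
def TwoSidedIdeal.comapInl {R₁ R₂ : Type*} [NonUnitalNonAssocRing R₁]
    [NonUnitalNonAssocRing R₂] (I : TwoSidedIdeal (R₁ × R₂)) : TwoSidedIdeal R₁ :=
  .mk' {a | (a, (0 : R₂)) ∈ I} I.zero_mem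
    (fun hx hy => by simpa using I.add_mem hx hy)
    (fun hx => by simpa using I.neg_mem hx)
    (fun {x _} hy => by simpa using I.mul_mem_left (x, 0) _ hy)
    (fun {_ y} hx => by simpa using I.mul_mem_right _ (y, 0) hx)

/-- The two-sided ideal of `R₂` consisting of all `b` with `(0, b) ∈ I`. -/
def TwoSidedIdeal.comapInr {R₁ R₂ : Type*} [NonUnitalNonAssocRing R₁]
    [NonUnitalNonAssocRing R₂] (I : TwoSidedIdeal (R₁ × R₂)) : TwoSidedIdeal R₂ :=
  .mk' {b | ((0 : R₁), b) ∈ I} I.zero_mem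
    (fun hx hy => by simpa using I.add_mem hx hy)
    (fun hx => by simpa using I.neg_mem hx)
    (fun {x _} hy => by simpa using I.mul_mem_left (0, x) _ hy)
    (fun {_ y} hx => by simpa using I.mul_mem_right _ (0, y) hx)

@[simp]
lemma TwoSidedIdeal.mem_comapInl {R₁ R₂ : Type*} [NonUnitalNonAssocRing R₁]
    [NonUnitalNonAssocRing R₂] {I : TwoSidedIdeal (R₁ × R₂)} {a : R₁} :
    a ∈ I.comapInl ↔ (a, (0 : R₂)) ∈ I :=
  TwoSidedIdeal.mem_mk' ..

@[simp]
lemma TwoSidedIdeal.mem_comapInr {R₁ R₂ : Type*} [NonUnitalNonAssocRing R₁]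
    [NonUnitalNonAssocRing R₂] {I : TwoSidedIdeal (R₁ × R₂)} {b : R₂} :
    b ∈ I.comapInr ↔ ((0 : R₁), b) ∈ I :=
  TwoSidedIdeal.mem_mk' ..

theorem directlyDecomposable_iff_proj_mem
    {R₁ R₂ : Type*} [NonUnitalRing R₁] [NonUnitalRing R₂]
    (I : TwoSidedIdeal (R₁ × R₂)) :
    IsDirectlyDecomposable I ↔
      ∀ (a : R₁) (b : R₂), (a, b) ∈ I → (a, (0 : R₂)) ∈ I ∧ ((0 : R₁), b) ∈ I := by
  constructor
  · rintro ⟨I₁, I₂, h⟩ a b hab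
    obtain ⟨ha, hb⟩ := (h _).1 hab
    exact ⟨(h _).2 ⟨ha, I₂.zero_mem⟩, (h _).2 ⟨I₁.zero_mem, hb⟩⟩
  · refine fun h => ⟨I.comapInl, I.comapInr, fun ⟨a, b⟩ => ?_⟩
    simp only [TwoSidedIdeal.mem_comapInl, TwoSidedIdeal.mem_comapInr]
    exact ⟨h a b, fun ⟨ha, hb⟩ => by simpa using I.add_mem ha hb⟩
end

section
/- Let R₁ and R₂ be (possibly non-unital, possibly non-commutative) rings and let I be a two-sided ideal of the direct product R₁ × R₂. Then I is directly decomposable if and only if the following two inclusions hold: (R₁ × {0}) ∩ (({0} × R₂) + I) ⊆ I and ((R₁ × {0}) + I) ∩ ({0} × R₂) ⊆ I, where for a subset S of R₁ × R₂, S + I denotes the set of all sums s + i with s ∈ S and i ∈ I. -/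
open Pointwise

/-- The two-sided ideal of `R₁` consisting of all `x` with `(x, 0) ∈ I`. -/
def TwoSidedIdeal.inlPreimage {R₁ R₂ : Type*} [NonUnitalNonAssocRing R₁]
    [NonUnitalNonAssocRing R₂] (I : TwoSidedIdeal (R₁ × R₂)) : TwoSidedIdeal R₁ :=
  .mk' {x | (x, 0) ∈ I} I.zero_mem
    (fun hx hy => by simpa using I.add_mem hx hy)
    (fun hx => by simpa using I.neg_mem hx)
    (fun {x _} hy => by simpa using I.mul_mem_left (x, 0) _ hy)
    (fun {_ y} hx => by simpa using I.mul_mem_right _ (y, 0) hx)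

/-- The two-sided ideal of `R₂` consisting of all `y` with `(0, y) ∈ I`. -/
def TwoSidedIdeal.inrPreimage {R₁ R₂ : Type*} [NonUnitalNonAssocRing R₁]
    [NonUnitalNonAssocRing R₂] (I : TwoSidedIdeal (R₁ × R₂)) : TwoSidedIdeal R₂ :=
  .mk' {y | (0, y) ∈ I} I.zero_mem
    (fun hx hy => by simpa using I.add_mem hx hy)
    (fun hx => by simpa using I.neg_mem hx)
    (fun {x _} hy => by simpa using I.mul_mem_left (0, x) _ hy)
    (fun {_ y} hx => by simpa using I.mul_mem_right _ (0, y) hx)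

@[simp]
theorem TwoSidedIdeal.mem_inlPreimage {R₁ R₂ : Type*} [NonUnitalNonAssocRing R₁]
    [NonUnitalNonAssocRing R₂] {I : TwoSidedIdeal (R₁ × R₂)} {x : R₁} :
    x ∈ I.inlPreimage ↔ (x, 0) ∈ I :=
  TwoSidedIdeal.mem_mk' ..

@[simp]
theorem TwoSidedIdeal.mem_inrPreimage {R₁ R₂ : Type*} [NonUnitalNonAssocRing R₁]
    [NonUnitalNonAssocRing R₂] {I : TwoSidedIdeal (R₁ × R₂)} {y : R₂} :
    y ∈ I.inrPreimage ↔ (0, y) ∈ I :=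
  TwoSidedIdeal.mem_mk' ..

theorem directlyDecomposable_iff_inclusions
    {R₁ R₂ : Type*} [NonUnitalRing R₁] [NonUnitalRing R₂]
    (I : TwoSidedIdeal (R₁ × R₂)) :
    IsDirectlyDecomposable I ↔
      ((Set.univ ×ˢ ({0} : Set R₂)) ∩ ((({0} : Set R₁) ×ˢ Set.univ) + (I : Set (R₁ × R₂)))
          ⊆ (I : Set (R₁ × R₂)) ∧
        (((Set.univ ×ˢ ({0} : Set R₂)) + (I : Set (R₁ × R₂))) ∩ (({0} : Set R₁) ×ˢ Set.univ)
          ⊆ (I : Set (R₁ × R₂)))) := by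
  constructor
  · rintro ⟨I₁, I₂, h⟩
    constructor
    · rintro _ ⟨⟨-, hp⟩, ⟨a, b⟩, ⟨ha, -⟩, ⟨c, d⟩, hi, rfl⟩
      obtain rfl : a = 0 := ha
      have hp : b + d = 0 := hp
      refine (h _).2 ⟨?_, ?_⟩
      · simpa using ((h _).1 hi).1
      · simp [hp]
    · rintro _ ⟨⟨⟨a, b⟩, ⟨-, hb⟩, ⟨c, d⟩, hi, rfl⟩, hp, -⟩
      obtain rfl : b = 0 := hb
      have hp : a + c = 0 := hp
      refine (h _).2 ⟨?_, ?_⟩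
      · simp [hp]
      · simpa using ((h _).1 hi).2
  · rintro ⟨h₁, h₂⟩
    refine ⟨I.inlPreimage, I.inrPreimage, fun ⟨x, y⟩ => ?_⟩
    simp only [TwoSidedIdeal.mem_inlPreimage, TwoSidedIdeal.mem_inrPreimage]
    refine ⟨fun h => ⟨?_, ?_⟩, fun ⟨hx, hy⟩ => by simpa using I.add_mem hx hy⟩
    · exact h₁ ⟨by simp, (0, -y), by simp, (x, y), h, by simp⟩
    · exact h₂ ⟨⟨(-x, 0), by simp, (x, y), h, by simp⟩, by simp⟩
end

section
/- Let R₁ and R₂ be (possibly non-unital, possibly non-commutative) rings and let I be a two-sided ideal of the direct product R₁ × R₂. Then I is directly decomposable if and only if ((R₁ × {0}) + I) ∩ (({0} × R₂) + I) = I, where for a subset S of R₁ × R₂, S + I denotes the set of all sums s + i with s ∈ S and i ∈ I. -/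
open Pointwise

namespace TwoSidedIdeal

variable {R₁ R₂ : Type*} [NonUnitalNonAssocRing R₁] [NonUnitalNonAssocRing R₂]

/-- The projection of a two-sided ideal of `R₁ × R₂` to `R₁`. -/
def projFst (I : TwoSidedIdeal (R₁ × R₂)) : TwoSidedIdeal R₁ :=
  .mk' {x | ∃ y, (x, y) ∈ I} ⟨0, I.zero_mem⟩
    (fun ⟨y, hy⟩ ⟨z, hz⟩ => ⟨y + z, I.add_mem hy hz⟩)
    (fun ⟨y, hy⟩ => ⟨-y, I.neg_mem hy⟩)
    (fun {a _} ⟨y, hy⟩ => ⟨0 * y, I.mul_mem_left (a, 0) _ hy⟩)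
    (fun {_ b} ⟨y, hy⟩ => ⟨y * 0, I.mul_mem_right _ (b, 0) hy⟩)

/-- The projection of a two-sided ideal of `R₁ × R₂` to `R₂`. -/
def projSnd (I : TwoSidedIdeal (R₁ × R₂)) : TwoSidedIdeal R₂ :=
  .mk' {y | ∃ x, (x, y) ∈ I} ⟨0, I.zero_mem⟩
    (fun ⟨y, hy⟩ ⟨z, hz⟩ => ⟨y + z, I.add_mem hy hz⟩)
    (fun ⟨y, hy⟩ => ⟨-y, I.neg_mem hy⟩)
    (fun {a _} ⟨y, hy⟩ => ⟨0 * y, I.mul_mem_left (0, a) _ hy⟩)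
    (fun {_ b} ⟨y, hy⟩ => ⟨y * 0, I.mul_mem_right _ (0, b) hy⟩)

@[simp]
lemma mem_projFst {I : TwoSidedIdeal (R₁ × R₂)} {x : R₁} :
    x ∈ I.projFst ↔ ∃ y, (x, y) ∈ I :=
  mem_mk' ..

@[simp]
lemma mem_projSnd {I : TwoSidedIdeal (R₁ × R₂)} {y : R₂} :
    y ∈ I.projSnd ↔ ∃ x, (x, y) ∈ I :=
  mem_mk' ..

lemma mem_univ_prod_zero_add {I : TwoSidedIdeal (R₁ × R₂)} {p : R₁ × R₂} :
    p ∈ ((Set.univ : Set R₁) ×ˢ ({0} : Set R₂)) + (I : Set (R₁ × R₂)) ↔ p.2 ∈ I.projSnd := by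
  rw [mem_projSnd, Set.mem_add]
  constructor
  · rintro ⟨⟨a, b⟩, ⟨-, rfl⟩, ⟨c, d⟩, hc, rfl⟩
    exact ⟨c, by simpa using hc⟩
  · rintro ⟨x, hx⟩
    exact ⟨(p.1 - x, 0), by simp, (x, p.2), hx, by ext <;> simp⟩

lemma mem_zero_prod_univ_add {I : TwoSidedIdeal (R₁ × R₂)} {p : R₁ × R₂} :
    p ∈ (({0} : Set R₁) ×ˢ (Set.univ : Set R₂)) + (I : Set (R₁ × R₂)) ↔ p.1 ∈ I.projFst := by
  rw [mem_projFst, Set.mem_add]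
  constructor
  · rintro ⟨⟨a, b⟩, ⟨rfl, -⟩, ⟨c, d⟩, hc, rfl⟩
    exact ⟨d, by simpa using hc⟩
  · rintro ⟨y, hy⟩
    exact ⟨(0, p.2 - y), by simp, (p.1, y), hy, by ext <;> simp⟩

end TwoSidedIdeal

theorem directlyDecomposable_iff_eq
    {R₁ R₂ : Type*} [NonUnitalRing R₁] [NonUnitalRing R₂]
    (I : TwoSidedIdeal (R₁ × R₂)) :
    IsDirectlyDecomposable I ↔
      ((Set.univ ×ˢ ({0} : Set R₂)) + (I : Set (R₁ × R₂))) ∩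
          ((({0} : Set R₁) ×ˢ Set.univ) + (I : Set (R₁ × R₂))) = (I : Set (R₁ × R₂)) := by
  simp only [Set.ext_iff, Set.mem_inter_iff, TwoSidedIdeal.mem_univ_prod_zero_add,
    TwoSidedIdeal.mem_zero_prod_univ_add, SetLike.mem_coe]
  constructor
  · rintro ⟨I₁, I₂, h⟩ p
    simp only [TwoSidedIdeal.mem_projFst, TwoSidedIdeal.mem_projSnd]
    constructor
    · rintro ⟨⟨x, hx⟩, ⟨y, hy⟩⟩
      exact (h p).2 ⟨((h _).1 hy).1, ((h _).1 hx).2⟩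
    · exact fun hp => ⟨⟨p.1, hp⟩, ⟨p.2, hp⟩⟩
  · exact fun h => ⟨I.projFst, I.projSnd, fun p => (h p).symm.trans and_comm⟩
end

section
/- Let R₁ and R₂ be (possibly non-unital, possibly non-commutative) rings. Then the lattice of two-sided ideals of R₁ × R₂ (ordered by inclusion, with meet given by intersection and join by sum) is distributive if and only if every two-sided ideal of R₁ × R₂ is directly decomposable and both the lattice of two-sided ideals of R₁ and the lattice of two-sided ideals of R₂ are distributive. (A lattice is distributive if I ⊓ (J ⊔ K) = (I ⊓ J) ⊔ (I ⊓ K) for all elements I, J, K.) -/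
open Pointwise

namespace TwoSidedIdeal

section Comap

variable {R S : Type*} [NonUnitalNonAssocRing R] [NonUnitalNonAssocRing S]

theorem comap_inf (f : R →ₙ+* S) (I J : TwoSidedIdeal S) :
    (I ⊓ J).comap f = I.comap f ⊓ J.comap f := by
  ext x
  simp only [mem_comap, mem_inf]

theorem comap_sup_of_surjective {f : R →ₙ+* S} (hf : Function.Surjective f)
    (I J : TwoSidedIdeal S) : (I ⊔ J).comap f = I.comap f ⊔ J.comap f := by
  ext x
  simp only [mem_comap, mem_sup]
  constructor
  · rintro ⟨y, hy, z, hz, h⟩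
    obtain ⟨a, rfl⟩ := hf y
    refine ⟨a, hy, x - a, ?_, add_sub_cancel a x⟩
    rwa [map_sub, ← h, add_sub_cancel_left]
  · rintro ⟨y, hy, z, hz, rfl⟩
    exact ⟨f y, hy, f z, hz, (map_add f y z).symm⟩

theorem comap_injective_of_surjective {f : R →ₙ+* S} (hf : Function.Surjective f) :
    Function.Injective (comap f) := by
  intro I J h
  ext y
  obtain ⟨x, rfl⟩ := hf y
  rw [← mem_comap, h, mem_comap]

/-- Distributivity of the lattice of two-sided ideals passes to quotients. -/
theorem inf_sup_left_of_surjective {f : R →ₙ+* S} (hf : Function.Surjective f)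
    (h : ∀ I J K : TwoSidedIdeal R, I ⊓ (J ⊔ K) = (I ⊓ J) ⊔ (I ⊓ K))
    (I J K : TwoSidedIdeal S) : I ⊓ (J ⊔ K) = (I ⊓ J) ⊔ (I ⊓ K) := by
  apply comap_injective_of_surjective hf
  simp only [comap_inf, comap_sup_of_surjective hf, h]

end Comap

section Prod

variable {R₁ R₂ : Type*} [NonUnitalNonAssocRing R₁] [NonUnitalNonAssocRing R₂]

/-- The product of two two-sided ideals. -/
def prod (I₁ : TwoSidedIdeal R₁) (I₂ : TwoSidedIdeal R₂) : TwoSidedIdeal (R₁ × R₂) :=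
  I₁.comap (NonUnitalRingHom.fst R₁ R₂) ⊓ I₂.comap (NonUnitalRingHom.snd R₁ R₂)

@[simp]
theorem mem_prod {I₁ : TwoSidedIdeal R₁} {I₂ : TwoSidedIdeal R₂} {p : R₁ × R₂} :
    p ∈ I₁.prod I₂ ↔ p.1 ∈ I₁ ∧ p.2 ∈ I₂ := by
  simp [prod, mem_inf, mem_comap]

theorem isDirectlyDecomposable_iff_exists_eq_prod {I : TwoSidedIdeal (R₁ × R₂)} :
    IsDirectlyDecomposable I ↔ ∃ I₁ I₂, I = prod I₁ I₂ := by
  simp only [IsDirectlyDecomposable, TwoSidedIdeal.ext_iff, mem_prod]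

theorem prod_inf_prod (I₁ J₁ : TwoSidedIdeal R₁) (I₂ J₂ : TwoSidedIdeal R₂) :
    I₁.prod I₂ ⊓ J₁.prod J₂ = (I₁ ⊓ J₁).prod (I₂ ⊓ J₂) := by
  ext p
  simp only [mem_inf, mem_prod]
  tauto

theorem prod_sup_prod (I₁ J₁ : TwoSidedIdeal R₁) (I₂ J₂ : TwoSidedIdeal R₂) :
    I₁.prod I₂ ⊔ J₁.prod J₂ = (I₁ ⊔ J₁).prod (I₂ ⊔ J₂) := by
  ext p
  simp only [mem_sup, mem_prod]
  constructor
  · rintro ⟨y, ⟨hy₁, hy₂⟩, z, ⟨hz₁, hz₂⟩, rfl⟩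
    exact ⟨⟨y.1, hy₁, z.1, hz₁, rfl⟩, ⟨y.2, hy₂, z.2, hz₂, rfl⟩⟩
  · rintro ⟨⟨y₁, hy₁, z₁, hz₁, h₁⟩, ⟨y₂, hy₂, z₂, hz₂, h₂⟩⟩
    exact ⟨(y₁, y₂), ⟨hy₁, hy₂⟩, (z₁, z₂), ⟨hz₁, hz₂⟩, Prod.ext h₁ h₂⟩

theorem isDirectlyDecomposable_of_forall_mem {I : TwoSidedIdeal (R₁ × R₂)}
    (h : ∀ p ∈ I, (p.1, 0) ∈ I ∧ (0, p.2) ∈ I) : IsDirectlyDecomposable I := by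
  refine ⟨mk' {x | (x, 0) ∈ I} I.zero_mem ?_ ?_ ?_ ?_,
    mk' {y | (0, y) ∈ I} I.zero_mem ?_ ?_ ?_ ?_, fun p => ?_⟩
  · intro x y hx hy
    simpa using I.add_mem hx hy
  · intro x hx
    simpa using I.neg_mem hx
  · intro x y hy
    simpa using I.mul_mem_left (x, 0) _ hy
  · intro x y hx
    simpa using I.mul_mem_right _ (y, 0) hx
  · intro x y hx hy
    simpa using I.add_mem hx hy
  · intro x hx
    simpa using I.neg_mem hx
  · intro x y hy
    simpa using I.mul_mem_left (0, x) _ hy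
  · intro x y hx
    simpa using I.mul_mem_right _ (0, y) hx
  · simp only [mem_mk', Set.mem_ofPred_eq]
    refine ⟨h p, fun hp => ?_⟩
    simpa using I.add_mem hp.1 hp.2

theorem isDirectlyDecomposable_of_inf_sup_left
    (h : ∀ I J K : TwoSidedIdeal (R₁ × R₂), I ⊓ (J ⊔ K) = (I ⊓ J) ⊔ (I ⊓ K))
    (I : TwoSidedIdeal (R₁ × R₂)) : IsDirectlyDecomposable I := by
  refine isDirectlyDecomposable_of_forall_mem fun p hp => ?_
  have hp' : p ∈ I ⊓ (prod ⊤ ⊥ ⊔ prod ⊥ ⊤) := by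
    rw [prod_sup_prod]
    simpa [mem_inf] using hp
  rw [h, mem_sup] at hp'
  obtain ⟨⟨a, b⟩, ha, ⟨c, d⟩, hc, rfl⟩ := hp'
  simp only [mem_inf, mem_prod, mem_top, mem_bot, true_and, and_true] at ha hc
  obtain ⟨ha, rfl⟩ := ha
  obtain ⟨hc, rfl⟩ := hc
  simpa using ⟨ha, hc⟩

end Prod

end TwoSidedIdeal


theorem idealLattice_distrib_iff
    {R₁ R₂ : Type*} [NonUnitalRing R₁] [NonUnitalRing R₂] :
    (∀ I J K : TwoSidedIdeal (R₁ × R₂), I ⊓ (J ⊔ K) = (I ⊓ J) ⊔ (I ⊓ K)) ↔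
      ((∀ I : TwoSidedIdeal (R₁ × R₂), IsDirectlyDecomposable I) ∧
        (∀ I J K : TwoSidedIdeal R₁, I ⊓ (J ⊔ K) = (I ⊓ J) ⊔ (I ⊓ K)) ∧
        (∀ I J K : TwoSidedIdeal R₂, I ⊓ (J ⊔ K) = (I ⊓ J) ⊔ (I ⊓ K))) := by
  constructor
  · intro h
    exact ⟨TwoSidedIdeal.isDirectlyDecomposable_of_inf_sup_left h,
      TwoSidedIdeal.inf_sup_left_of_surjective (f := NonUnitalRingHom.fst R₁ R₂)
        Prod.fst_surjective h,
      TwoSidedIdeal.inf_sup_left_of_surjective (f := NonUnitalRingHom.snd R₁ R₂)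
        Prod.snd_surjective h⟩
  · rintro ⟨hd, h₁, h₂⟩ I J K
    simp only [TwoSidedIdeal.isDirectlyDecomposable_iff_exists_eq_prod] at hd
    obtain ⟨I₁, I₂, rfl⟩ := hd I
    obtain ⟨J₁, J₂, rfl⟩ := hd J
    obtain ⟨K₁, K₂, rfl⟩ := hd K
    simp only [TwoSidedIdeal.prod_inf_prod, TwoSidedIdeal.prod_sup_prod, h₁, h₂]
end

section
/- Let R₁ be a (possibly non-unital) ring satisfying x·x = x for all x ∈ R₁ (a Boolean ring) and let R₂ be a unital ring. Then every two-sided ideal of the direct product R₁ × R₂ is directly decomposable. -/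
open Pointwise

theorem isDirectlyDecomposable_of_forall_inl_mem {R₁ R₂ : Type*}
    [NonUnitalNonAssocRing R₁] [NonUnitalNonAssocRing R₂] {I : TwoSidedIdeal (R₁ × R₂)}
    (h : ∀ p ∈ I, (p.1, (0 : R₂)) ∈ I) : IsDirectlyDecomposable I := by
  refine ⟨I.comap (NonUnitalAlgHom.inl ℤ R₁ R₂), I.comap (NonUnitalAlgHom.inr ℤ R₁ R₂),
    fun p => ?_⟩
  simp only [TwoSidedIdeal.mem_comap, NonUnitalAlgHom.inl_apply, NonUnitalAlgHom.inr_apply]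
  refine ⟨fun hp => ⟨h p hp, ?_⟩, fun hp => ?_⟩
  · simpa [Prod.sub_def] using I.sub_mem hp (h p hp)
  · simpa using I.add_mem hp.1 hp.2

theorem directlyDecomposable_of_boolean_unital
    {R₁ R₂ : Type*} [NonUnitalRing R₁] [Ring R₂]
    (hbool : ∀ x : R₁, x * x = x)
    (I : TwoSidedIdeal (R₁ × R₂)) :
    IsDirectlyDecomposable I := by
  refine isDirectlyDecomposable_of_forall_inl_mem fun p hp => ?_
  simpa [Prod.mul_def, hbool] using I.mul_mem_right p (p.1, 0) hp
end

section
/- Let a, b, c, d be integers with c ∣ a and d ∣ b, and let I(a,b) denote the two-sided ideal of the non-unital ring cℤ × dℤ generated by the element (a,b). Then I(a,b) is directly decomposable if and only if a = 0 or b = 0 or gcd(c,d) = 1. -/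
open Pointwise

/-- The non-unital subring `cℤ` of `ℤ` consisting of all integer multiples of `c`. -/
def intMultiples (c : ℤ) : NonUnitalSubring ℤ where
  carrier := {x : ℤ | c ∣ x}
  add_mem' := fun h₁ h₂ => dvd_add h₁ h₂
  zero_mem' := dvd_zero c
  neg_mem' := fun h => dvd_neg.mpr h
  mul_mem' := fun {_ y} h _ => Dvd.dvd.mul_right h y

section DirectProduct

variable {R₁ R₂ : Type*} [NonUnitalNonAssocRing R₁] [NonUnitalNonAssocRing R₂]

/-- A two-sided ideal of `R₁ × R₂` is directly decomposable if and only if it is stable under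
projection onto the first factor. -/
theorem isDirectlyDecomposable_iff_forall_mem {I : TwoSidedIdeal (R₁ × R₂)} :
    IsDirectlyDecomposable I ↔ ∀ p ∈ I, (p.1, (0 : R₂)) ∈ I := by
  constructor
  · rintro ⟨I₁, I₂, h⟩ p hp
    exact (h _).2 ⟨((h p).1 hp).1, I₂.zero_mem⟩
  · intro h
    let inl : R₁ →ₙ+* R₁ × R₂ := (NonUnitalRingHom.id R₁).prod 0
    let inr : R₂ →ₙ+* R₁ × R₂ := NonUnitalRingHom.prod 0 (NonUnitalRingHom.id R₂)
    refine ⟨I.comap inl, I.comap inr, fun p ↦ ?_⟩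
    rw [TwoSidedIdeal.mem_comap, TwoSidedIdeal.mem_comap]
    change p ∈ I ↔ (p.1, (0 : R₂)) ∈ I ∧ ((0 : R₁), p.2) ∈ I
    constructor
    · intro hp
      have hsub : ((0 : R₁), p.2) = p - (p.1, 0) := by ext <;> simp
      exact ⟨h p hp, hsub ▸ I.sub_mem hp (h p hp)⟩
    · rintro ⟨h₁, h₂⟩
      simpa using! I.add_mem h₁ h₂

/-- A principal two-sided ideal of `R₁ × R₂` is directly decomposable if and only if it contains
the projection of its generator onto the first factor. -/
theorem isDirectlyDecomposable_span_singleton_iff {x : R₁} {y : R₂} :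
    IsDirectlyDecomposable (TwoSidedIdeal.span {(x, y)}) ↔
      (x, (0 : R₂)) ∈ TwoSidedIdeal.span {(x, y)} := by
  rw [isDirectlyDecomposable_iff_forall_mem]
  refine ⟨fun h ↦ h _ (TwoSidedIdeal.subset_span rfl), fun h p hp ↦ ?_⟩
  let proj : R₁ × R₂ →ₙ+* R₁ × R₂ := (NonUnitalRingHom.fst R₁ R₂).prod 0
  have hle : TwoSidedIdeal.span {(x, y)} ≤ (TwoSidedIdeal.span {(x, y)}).comap proj := by
    rw [TwoSidedIdeal.span_le, Set.singleton_subset_iff, SetLike.mem_coe,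
      TwoSidedIdeal.mem_comap]
    exact h
  exact (TwoSidedIdeal.mem_comap proj).1 (hle hp)

end DirectProduct

/-- The two-sided ideal of `cℤ × dℤ` consisting of the pairs `(a * m, b * n)` with
`m ≡ n` modulo `gcd c d`. -/
def congruenceIdeal (a b c d : ℤ) : TwoSidedIdeal (intMultiples c × intMultiples d) :=
  TwoSidedIdeal.mk'
    {p | ∃ m n : ℤ, (p.1 : ℤ) = a * m ∧ (p.2 : ℤ) = b * n ∧ (Int.gcd c d : ℤ) ∣ m - n}
    ⟨0, 0, by simp⟩
    (by
      rintro x y ⟨m, n, hm, hn, h⟩ ⟨m', n', hm', hn', h'⟩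
      refine ⟨m + m', n + n', ?_, ?_, ?_⟩
      · simp [hm, hm', mul_add]
      · simp [hn, hn', mul_add]
      · rw [add_sub_add_comm]
        exact dvd_add h h')
    (by
      rintro x ⟨m, n, hm, hn, h⟩
      refine ⟨-m, -n, ?_, ?_, ?_⟩
      · simp [hm]
      · simp [hn]
      · rw [neg_sub_neg, dvd_sub_comm]
        exact h)
    (by
      rintro ⟨⟨r, hr⟩, ⟨s, hs⟩⟩ y ⟨m, n, hm, hn, -⟩
      refine ⟨m * r, n * s, ?_, ?_, ?_⟩
      · simp [hm, mul_comm, mul_left_comm]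
      · simp [hn, mul_comm, mul_left_comm]
      · exact dvd_sub (((Int.gcd_dvd_left c d).trans hr).mul_left m)
          (((Int.gcd_dvd_right c d).trans hs).mul_left n))
    (by
      rintro x ⟨⟨r, hr⟩, ⟨s, hs⟩⟩ ⟨m, n, hm, hn, -⟩
      refine ⟨m * r, n * s, ?_, ?_, ?_⟩
      · simp [hm, mul_assoc]
      · simp [hn, mul_assoc]
      · exact dvd_sub (((Int.gcd_dvd_left c d).trans hr).mul_left m)
          (((Int.gcd_dvd_right c d).trans hs).mul_left n))

theorem mem_congruenceIdeal {a b c d : ℤ} {p : intMultiples c × intMultiples d} :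
    p ∈ congruenceIdeal a b c d ↔
      ∃ m n : ℤ, (p.1 : ℤ) = a * m ∧ (p.2 : ℤ) = b * n ∧ (Int.gcd c d : ℤ) ∣ m - n :=
  TwoSidedIdeal.mem_mk' ..

theorem span_directlyDecomposable_iff (a b c d : ℤ) (hc : c ∣ a) (hd : d ∣ b) :
    IsDirectlyDecomposable
        (TwoSidedIdeal.span {((⟨a, hc⟩, ⟨b, hd⟩) : intMultiples c × intMultiples d)}) ↔
      a = 0 ∨ b = 0 ∨ Int.gcd c d = 1 := by
  rw [isDirectlyDecomposable_span_singleton_iff]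
  have hgen := TwoSidedIdeal.subset_span (Set.mem_singleton
    ((⟨a, hc⟩, ⟨b, hd⟩) : intMultiples c × intMultiples d))
  rw [SetLike.mem_coe] at hgen
  constructor
  · intro h
    by_contra! hne
    obtain ⟨ha, hb, hg⟩ := hne
    have hle : TwoSidedIdeal.span {((⟨a, hc⟩, ⟨b, hd⟩) : intMultiples c × intMultiples d)} ≤
        congruenceIdeal a b c d := by
      rw [TwoSidedIdeal.span_le, Set.singleton_subset_iff, SetLike.mem_coe, mem_congruenceIdeal]
      exact ⟨1, 1, by simp⟩
    obtain ⟨m, n, hm, hn, hdvd⟩ := mem_congruenceIdeal.1 (hle h)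
    obtain rfl : m = 1 := mul_left_cancel₀ ha (by simpa using hm.symm)
    obtain rfl : n = 0 := by simpa [hb] using hn
    rw [sub_zero] at hdvd
    exact hg (Nat.dvd_one.1 (by exact_mod_cast hdvd))
  · rintro (rfl | rfl | hg)
    · exact TwoSidedIdeal.zero_mem _
    · exact hgen
    · obtain ⟨k, l, hkl⟩ := Int.isCoprime_iff_gcd_eq_one.2 hg
      let r : intMultiples c × intMultiples d :=
        (⟨k * c, dvd_mul_left c k⟩, ⟨-(l * d), (dvd_mul_left d l).neg_right⟩)
      convert TwoSidedIdeal.add_mem _ (TwoSidedIdeal.zsmul_mem _ (l * d) hgen)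
        (TwoSidedIdeal.mul_mem_left _ r _ hgen) using 1
      ext
      · simp [r]
        linear_combination -a * hkl
      · simp [r]
end

section
/- Let a, b, c, d be integers with c ∣ a and d ∣ b, and suppose gcd(c,d) = 1. Then the two-sided ideal of the non-unital ring cℤ × dℤ generated by the element (a,b) is directly decomposable. -/
open Pointwise

/-- The ideal spanned by `s` is directly decomposable as soon as it contains the first components
`(p.1, 0)` of the generators `p ∈ s`. -/
theorem isDirectlyDecomposable_span_of_fst_mem {R₁ R₂ : Type*} [NonUnitalNonAssocRing R₁]
    [NonUnitalNonAssocRing R₂] {s : Set (R₁ × R₂)}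
    (h : ∀ p ∈ s, ((p.1, 0) : R₁ × R₂) ∈ TwoSidedIdeal.span s) :
    IsDirectlyDecomposable (TwoSidedIdeal.span s) := by
  let inl := NonUnitalAlgHom.inl ℤ R₁ R₂
  let inr := NonUnitalAlgHom.inr ℤ R₁ R₂
  have fst_mem : TwoSidedIdeal.span s ≤
      (TwoSidedIdeal.span s).comap (inl.comp (NonUnitalAlgHom.fst ℤ R₁ R₂)) :=
    TwoSidedIdeal.span_le.2 fun p hp => TwoSidedIdeal.mem_comap _ |>.2 (h p hp)
  refine ⟨(TwoSidedIdeal.span s).comap inl, (TwoSidedIdeal.span s).comap inr, fun p => ?_⟩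
  simp only [TwoSidedIdeal.mem_comap]
  change p ∈ _ ↔ ((p.1, 0) : R₁ × R₂) ∈ _ ∧ ((0, p.2) : R₁ × R₂) ∈ _
  constructor
  · intro hp
    have hp₁ : ((p.1, 0) : R₁ × R₂) ∈ TwoSidedIdeal.span s :=
      (TwoSidedIdeal.mem_comap _).1 (fst_mem hp)
    exact ⟨hp₁, by simpa [Prod.sub_def] using TwoSidedIdeal.sub_mem _ hp hp₁⟩
  · rintro ⟨hp₁, hp₂⟩
    simpa using TwoSidedIdeal.add_mem _ hp₁ hp₂

theorem span_directlyDecomposable_of_coprime (a b c d : ℤ) (hc : c ∣ a) (hd : d ∣ b)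
    (hcd : Int.gcd c d = 1) :
    IsDirectlyDecomposable
      (TwoSidedIdeal.span {((⟨a, hc⟩, ⟨b, hd⟩) : intMultiples c × intMultiples d)}) := by
  apply isDirectlyDecomposable_span_of_fst_mem
  rintro _ rfl
  set g : intMultiples c × intMultiples d := (⟨a, hc⟩, ⟨b, hd⟩)
  have hg : g ∈ TwoSidedIdeal.span {g} := TwoSidedIdeal.subset_span rfl
  have hbezout : c * Int.gcdA c d + d * Int.gcdB c d = 1 := by
    rw [← Int.gcd_eq_gcd_ab, hcd, Nat.cast_one]
  have h₁ := TwoSidedIdeal.mul_mem_right _ g (⟨c, dvd_refl c⟩, 0) hg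
  have h₂ := TwoSidedIdeal.mul_mem_right _ g (0, ⟨d, dvd_refl d⟩) hg
  convert TwoSidedIdeal.add_mem _ (TwoSidedIdeal.zsmul_mem _ (Int.gcdA c d) h₁)
    (TwoSidedIdeal.sub_mem _ (TwoSidedIdeal.zsmul_mem _ (d * Int.gcdB c d) hg)
      (TwoSidedIdeal.zsmul_mem _ (Int.gcdB c d) h₂)) using 1
  ext
  · simp [g]
    linear_combination -a * hbezout
  · simp [g]
    ring
end

section
/- Let a, b, c, d be integers with c ∣ a, d ∣ b, a ≠ 0, b ≠ 0 and gcd(c,d) ≠ 1. Then the two-sided ideal I(a,b) of the non-unital ring cℤ × dℤ generated by the element (a,b) is not directly decomposable; in particular, (a,0) ∉ I(a,b). -/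
open Pointwise

/-- The two-sided ideal of `cℤ × dℤ` of the pairs `(a * x, b * y)` with
`x` congruent to `y` modulo `gcd c d`. -/
def congruentMultiplesIdeal (a b c d : ℤ) :
    TwoSidedIdeal (intMultiples c × intMultiples d) :=
  TwoSidedIdeal.mk'
    {p | ∃ x y : ℤ, (p.1 : ℤ) = a * x ∧ (p.2 : ℤ) = b * y ∧ (Int.gcd c d : ℤ) ∣ x - y}
    ⟨0, 0, by simp⟩
    (by
      rintro p q ⟨x, y, hx, hy, h⟩ ⟨x', y', hx', hy', h'⟩
      refine ⟨x + x', y + y', ?_, ?_, ?_⟩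
      · simp [hx, hx', mul_add]
      · simp [hy, hy', mul_add]
      · simpa only [add_sub_add_comm] using dvd_add h h')
    (by
      rintro p ⟨x, y, hx, hy, h⟩
      refine ⟨-x, -y, by simp [hx], by simp [hy], ?_⟩
      rw [neg_sub_neg]
      exact (dvd_sub_comm).mp h)
    (by
      rintro ⟨⟨u, hu⟩, ⟨v, hv⟩⟩ p ⟨x, y, hx, hy, -⟩
      refine ⟨u * x, v * y, ?_, ?_, ?_⟩
      · simp [hx, mul_left_comm]
      · simp [hy, mul_left_comm]
      · exact dvd_sub (((Int.gcd_dvd_left ..).trans hu).mul_right x)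
          (((Int.gcd_dvd_right ..).trans hv).mul_right y))
    (by
      rintro p ⟨⟨u, hu⟩, ⟨v, hv⟩⟩ ⟨x, y, hx, hy, -⟩
      refine ⟨x * u, y * v, ?_, ?_, ?_⟩
      · simp [hx, mul_assoc]
      · simp [hy, mul_assoc]
      · exact dvd_sub (((Int.gcd_dvd_left ..).trans hu).mul_left x)
          (((Int.gcd_dvd_right ..).trans hv).mul_left y))

theorem mem_congruentMultiplesIdeal {a b c d : ℤ} {p : intMultiples c × intMultiples d} :
    p ∈ congruentMultiplesIdeal a b c d ↔
      ∃ x y : ℤ, (p.1 : ℤ) = a * x ∧ (p.2 : ℤ) = b * y ∧ (Int.gcd c d : ℤ) ∣ x - y :=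
  TwoSidedIdeal.mem_mk' ..

theorem span_not_directlyDecomposable_of_not_coprime (a b c d : ℤ) (hc : c ∣ a) (hd : d ∣ b)
    (ha : a ≠ 0) (hb : b ≠ 0) (hcd : Int.gcd c d ≠ 1) :
    ¬ IsDirectlyDecomposable
        (TwoSidedIdeal.span {((⟨a, hc⟩, ⟨b, hd⟩) : intMultiples c × intMultiples d)}) ∧
      ((⟨a, hc⟩, ⟨(0 : ℤ), dvd_zero d⟩) : intMultiples c × intMultiples d) ∉
        TwoSidedIdeal.span {((⟨a, hc⟩, ⟨b, hd⟩) : intMultiples c × intMultiples d)} := by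
  have not_mem : ((⟨a, hc⟩, ⟨(0 : ℤ), dvd_zero d⟩) : intMultiples c × intMultiples d) ∉
      TwoSidedIdeal.span {((⟨a, hc⟩, ⟨b, hd⟩) : intMultiples c × intMultiples d)} := by
    intro h
    have hI := TwoSidedIdeal.mem_span_iff.mp h (congruentMultiplesIdeal a b c d)
      (Set.singleton_subset_iff.mpr
        (mem_congruentMultiplesIdeal.mpr ⟨1, 1, by simp, by simp, by simp⟩))
    obtain ⟨x, y, hx, hy, hxy⟩ := mem_congruentMultiplesIdeal.mp hI
    have hx1 : x = 1 := (mul_eq_left₀ ha).mp hx.symm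
    have hy0 : y = 0 := (mul_eq_zero_iff_left hb).mp hy.symm
    rw [hx1, hy0, sub_zero] at hxy
    exact hcd (Nat.dvd_one.mp (by exact_mod_cast hxy))
  refine ⟨?_, not_mem⟩
  rintro ⟨I₁, I₂, h⟩
  exact not_mem ((h _).mpr
    ⟨((h _).mp (TwoSidedIdeal.subset_span (Set.mem_singleton _))).1, I₂.zero_mem⟩)
end

section
/- Let c and d be nonzero integers with gcd(c,d) ≠ 1. Then the non-unital ring cℤ × dℤ has a skew two-sided ideal, i.e., there exists a two-sided ideal of cℤ × dℤ that is not directly decomposable. -/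
open Pointwise

/-- The two-sided ideal of `cℤ × dℤ` of all pairs `(c * a, d * b)` with `a ≡ b` modulo `g`,
where `g` is a common divisor of `c` and `d`. -/
def congruentCoefficientsIdeal {c d g : ℤ} (hgc : g ∣ c) (hgd : g ∣ d) :
    TwoSidedIdeal (intMultiples c × intMultiples d) :=
  .mk' {p | ∃ a b : ℤ, (p.1 : ℤ) = c * a ∧ (p.2 : ℤ) = d * b ∧ g ∣ a - b}
    ⟨0, 0, by simp⟩
    (by
      rintro x y ⟨a, b, ha, hb, h⟩ ⟨a', b', ha', hb', h'⟩
      refine ⟨a + a', b + b', by simp [ha, ha', mul_add], by simp [hb, hb', mul_add], ?_⟩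
      rw [add_sub_add_comm]
      exact dvd_add h h')
    (by
      rintro x ⟨a, b, ha, hb, h⟩
      refine ⟨-a, -b, by simp [ha], by simp [hb], ?_⟩
      rw [neg_sub_neg]
      exact (dvd_sub_comm).1 h)
    (by
      rintro ⟨⟨u, hu⟩, ⟨v, hv⟩⟩ y ⟨a, b, ha, hb, -⟩
      exact ⟨u * a, v * b, by simp [ha, mul_left_comm], by simp [hb, mul_left_comm],
        dvd_sub ((hgc.trans hu).mul_right a) ((hgd.trans hv).mul_right b)⟩)
    (by
      rintro x ⟨⟨u, hu⟩, ⟨v, hv⟩⟩ ⟨a, b, ha, hb, -⟩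
      exact ⟨a * u, b * v, by simp [ha, mul_assoc], by simp [hb, mul_assoc],
        dvd_sub ((hgc.trans hu).mul_left a) ((hgd.trans hv).mul_left b)⟩)

theorem mem_congruentCoefficientsIdeal {c d g : ℤ} (hgc : g ∣ c) (hgd : g ∣ d)
    (p : intMultiples c × intMultiples d) :
    p ∈ congruentCoefficientsIdeal hgc hgd ↔
      ∃ a b : ℤ, (p.1 : ℤ) = c * a ∧ (p.2 : ℤ) = d * b ∧ g ∣ a - b :=
  TwoSidedIdeal.mem_mk' ..

theorem exists_skew_ideal_of_not_coprime (c d : ℤ) (hc : c ≠ 0) (hd : d ≠ 0)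
    (hcd : Int.gcd c d ≠ 1) :
    ∃ I : TwoSidedIdeal (intMultiples c × intMultiples d), ¬ IsDirectlyDecomposable I := by
  have hgc := Int.gcd_dvd_left c d
  have hgd := Int.gcd_dvd_right c d
  refine ⟨congruentCoefficientsIdeal hgc hgd, ?_⟩
  rintro ⟨I₁, I₂, hI⟩
  let x : intMultiples c := ⟨c, dvd_refl c⟩
  let y : intMultiples d := ⟨d, dvd_refl d⟩
  have hxy : (x, y) ∈ congruentCoefficientsIdeal hgc hgd :=
    (mem_congruentCoefficientsIdeal hgc hgd _).2 ⟨1, 1, by simp [x], by simp [y], by simp⟩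
  have hx : (x, (0 : intMultiples d)) ∈ congruentCoefficientsIdeal hgc hgd :=
    (hI _).2 ⟨((hI _).1 hxy).1, I₂.zero_mem⟩
  obtain ⟨a, b, ha, hb, h⟩ := (mem_congruentCoefficientsIdeal hgc hgd _).1 hx
  obtain rfl : a = 1 := by simpa [x, hc] using ha
  obtain rfl : b = 0 := by simpa [hd] using hb
  rw [sub_zero] at h
  exact hcd (by exact_mod_cast Int.eq_one_of_dvd_one (Int.natCast_nonneg _) h)
end

section
/- In the non-unital ring 2ℤ × 2ℤ, the two-sided ideal I(2,2) generated by the element (2,2) satisfies (0,2) ∉ I(2,2); consequently I(2,2) is skew, i.e., not directly decomposable. -/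
open Pointwise

/-- The two-sided ideal of `cℤ × cℤ` of pairs whose entries are congruent modulo `c * c`. -/
def congruentPairs (c : ℤ) : TwoSidedIdeal (intMultiples c × intMultiples c) :=
  .mk' {p | c * c ∣ (p.1 : ℤ) - p.2}
    (by simp)
    (fun {p q} hp hq => by
      have h := dvd_add hp hq
      rwa [sub_add_sub_comm] at h)
    (fun {p} hp => by
      have h := dvd_neg.mpr hp
      rwa [neg_sub'] at h)
    (fun {p q} _ => dvd_sub (mul_dvd_mul p.1.2 q.1.2) (mul_dvd_mul p.2.2 q.2.2))
    (fun {p q} _ => dvd_sub (mul_dvd_mul p.1.2 q.1.2) (mul_dvd_mul p.2.2 q.2.2))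

theorem mem_congruentPairs {c : ℤ} {p : intMultiples c × intMultiples c} :
    p ∈ congruentPairs c ↔ c * c ∣ (p.1 : ℤ) - p.2 :=
  TwoSidedIdeal.mem_mk' _ _ _ _ _ _ _

/-- A directly decomposable ideal containing `(a, b)` contains `(0, b)`. -/
theorem IsDirectlyDecomposable.zero_mk_mem {R₁ R₂ : Type*} [NonUnitalNonAssocRing R₁]
    [NonUnitalNonAssocRing R₂] {I : TwoSidedIdeal (R₁ × R₂)} (hI : IsDirectlyDecomposable I)
    {a : R₁} {b : R₂} (h : (a, b) ∈ I) : (0, b) ∈ I := by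
  obtain ⟨I₁, I₂, hmem⟩ := hI
  exact (hmem _).2 ⟨I₁.zero_mem, ((hmem _).1 h).2⟩

theorem span_two_two_skew :
    ((⟨(0 : ℤ), dvd_zero 2⟩, ⟨(2 : ℤ), dvd_refl 2⟩) : intMultiples 2 × intMultiples 2) ∉
        TwoSidedIdeal.span
          {((⟨(2 : ℤ), dvd_refl 2⟩, ⟨(2 : ℤ), dvd_refl 2⟩) : intMultiples 2 × intMultiples 2)} ∧
      ¬ IsDirectlyDecomposable
        (TwoSidedIdeal.span
          {((⟨(2 : ℤ), dvd_refl 2⟩, ⟨(2 : ℤ), dvd_refl 2⟩) : intMultiples 2 × intMultiples 2)}) := by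
  refine (and_iff_left_of_imp fun h hI => h (hI.zero_mk_mem
    (TwoSidedIdeal.subset_span (Set.mem_singleton _)))).2 fun h => ?_
  have hle : TwoSidedIdeal.span
      {((⟨(2 : ℤ), dvd_refl 2⟩, ⟨(2 : ℤ), dvd_refl 2⟩) : intMultiples 2 × intMultiples 2)} ≤
        congruentPairs 2 :=
    TwoSidedIdeal.span_le.2 (Set.singleton_subset_iff.2 (mem_congruentPairs.2 (by simp)))
  have h4 := mem_congruentPairs.1 (hle h)
  norm_num at h4
end

section
/- Let R₁ and R₂ be non-unital commutative rings such that for every x ∈ R₁ there exists y in the non-unital subring of R₁ generated by {x} with x·y = x, and likewise for every x ∈ R₂ there exists y in the non-unital subring of R₂ generated by {x} with x·y = x. Then every two-sided ideal of the direct product R₁ × R₂ is directly decomposable. -/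
open Pointwise

theorem directlyDecomposable_of_local_units
    {R₁ R₂ : Type*} [NonUnitalCommRing R₁] [NonUnitalCommRing R₂]
    (h₁ : ∀ x : R₁, ∃ y ∈ NonUnitalSubring.closure ({x} : Set R₁), x * y = x)
    (h₂ : ∀ x : R₂, ∃ y ∈ NonUnitalSubring.closure ({x} : Set R₂), x * y = x)
    (I : TwoSidedIdeal (R₁ × R₂)) :
    IsDirectlyDecomposable I := by
  refine ⟨I.comap (NonUnitalAlgHom.inl ℤ R₁ R₂), I.comap (NonUnitalAlgHom.inr ℤ R₁ R₂), ?_⟩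
  rintro ⟨a, b⟩
  simp only [TwoSidedIdeal.mem_comap, NonUnitalAlgHom.inl_apply, NonUnitalAlgHom.inr_apply]
  constructor
  · intro h
    obtain ⟨u, -, hu⟩ := h₁ a
    obtain ⟨v, -, hv⟩ := h₂ b
    exact ⟨by simpa [hu] using I.mul_mem_right (a, b) (u, 0) h,
      by simpa [hv] using I.mul_mem_right (a, b) (0, v) h⟩
  · rintro ⟨ha, hb⟩
    simpa using I.add_mem ha hb
end

section
/- Let F be the non-unital commutative ring of polynomials over ℤ with zero constant term (the non-unital subring of ℤ[X] consisting of all p with p(0) = 0); F is the free commutative ring on one generator X. Then the two-sided ideal of F × F generated by the element (X,X) does not contain (X,0); consequently this ideal is skew, i.e., not directly decomposable. -/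
open Pointwise

/-- The non-unital subring of `ℤ[X]` consisting of the polynomials with zero constant term;
this is the free commutative ring on one generator `X`. -/
noncomputable def zeroConstantTerm : NonUnitalSubring (Polynomial ℤ) where
  carrier := {p : Polynomial ℤ | p.coeff 0 = 0}
  add_mem' := by
    intro p q hp hq
    simp only [Set.mem_setOf_eq, Polynomial.coeff_add] at *
    rw [hp, hq, add_zero]
  zero_mem' := by simp
  neg_mem' := by
    intro p hp
    simp only [Set.mem_setOf_eq, Polynomial.coeff_neg] at *
    rw [hp, neg_zero]
  mul_mem' := by
    intro p q hp hq
    simp only [Set.mem_setOf_eq, Polynomial.mul_coeff_zero] at *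
    rw [hp, hq, mul_zero]

/-- A product of two polynomials without constant term has no linear term. -/
lemma coeff_one_mul_of_mem_zeroConstantTerm (p q : zeroConstantTerm) :
    ((p * q : zeroConstantTerm) : Polynomial ℤ).coeff 1 = 0 := by
  have hp : (p : Polynomial ℤ).coeff 0 = 0 := p.2
  have hq : (q : Polynomial ℤ).coeff 0 = 0 := q.2
  simp [Polynomial.mul_coeff_one, hp, hq]

/-- The two-sided ideal of pairs whose components have the same linear coefficient. -/
noncomputable def equalLinearCoeff : TwoSidedIdeal (zeroConstantTerm × zeroConstantTerm) :=
  TwoSidedIdeal.mk'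
    {p | (p.1 : Polynomial ℤ).coeff 1 = (p.2 : Polynomial ℤ).coeff 1}
    rfl
    (fun hx hy => by simp_all)
    (fun hx => by simp_all)
    (fun {x y} _ => (coeff_one_mul_of_mem_zeroConstantTerm x.1 y.1).trans
      (coeff_one_mul_of_mem_zeroConstantTerm x.2 y.2).symm)
    (fun {x y} _ => (coeff_one_mul_of_mem_zeroConstantTerm x.1 y.1).trans
      (coeff_one_mul_of_mem_zeroConstantTerm x.2 y.2).symm)

lemma mem_equalLinearCoeff {p : zeroConstantTerm × zeroConstantTerm} :
    p ∈ equalLinearCoeff ↔ (p.1 : Polynomial ℤ).coeff 1 = (p.2 : Polynomial ℤ).coeff 1 :=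
  TwoSidedIdeal.mem_mk' ..

theorem span_X_X_skew :
    ((⟨Polynomial.X, Polynomial.coeff_X_zero⟩, ⟨0, Polynomial.coeff_zero 0⟩) :
          zeroConstantTerm × zeroConstantTerm) ∉
        TwoSidedIdeal.span
          {((⟨Polynomial.X, Polynomial.coeff_X_zero⟩, ⟨Polynomial.X, Polynomial.coeff_X_zero⟩) :
            zeroConstantTerm × zeroConstantTerm)} ∧
      ¬ IsDirectlyDecomposable
        (TwoSidedIdeal.span
          {((⟨Polynomial.X, Polynomial.coeff_X_zero⟩, ⟨Polynomial.X, Polynomial.coeff_X_zero⟩) :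
            zeroConstantTerm × zeroConstantTerm)}) := by
  refine and_iff_left_of_imp (fun h => ?_) |>.2 fun h => ?_
  · rintro ⟨I₁, I₂, hI⟩
    exact h ((hI _).2 ⟨((hI _).1 (TwoSidedIdeal.subset_span rfl)).1, I₂.zero_mem⟩)
  · have hle := TwoSidedIdeal.span_le.2
      (Set.singleton_subset_iff.2 (mem_equalLinearCoeff.2 rfl)) h
    simpa using mem_equalLinearCoeff.1 hle
end

section
/- Let R be a (possibly non-unital, possibly non-commutative) ring and F a field. Then every two-sided ideal of the direct product R × F is directly decomposable. More precisely, if I is a two-sided ideal of R × F and J = π₁(I) denotes the projection of I to R, then either I = J × {0} or I = J × F. -/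
open Pointwise

namespace TwoSidedIdeal

section NonUnitalNonAssocRing

variable {R S : Type*} [NonUnitalNonAssocRing R] [NonUnitalNonAssocRing S]

/-- The elements `x` with `(x, 0) ∈ I`, for a two-sided ideal `I` of a direct product. -/
def sliceLeft (I : TwoSidedIdeal (R × S)) : TwoSidedIdeal R :=
  .mk' {x | (x, 0) ∈ I} I.zero_mem
    (fun {x y} hx hy => by simpa using I.add_mem hx hy)
    (fun {x} hx => by simpa using I.neg_mem hx)
    (fun {x y} hy => by simpa using I.mul_mem_left (x, 0) _ hy)
    (fun {x y} hx => by simpa using I.mul_mem_right _ (y, 0) hx)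

/-- The elements `y` with `(0, y) ∈ I`, for a two-sided ideal `I` of a direct product. -/
def sliceRight (I : TwoSidedIdeal (R × S)) : TwoSidedIdeal S :=
  .mk' {y | (0, y) ∈ I} I.zero_mem
    (fun {x y} hx hy => by simpa using I.add_mem hx hy)
    (fun {x} hx => by simpa using I.neg_mem hx)
    (fun {x y} hy => by simpa using I.mul_mem_left (0, x) _ hy)
    (fun {x y} hx => by simpa using I.mul_mem_right _ (0, y) hx)

@[simp]
lemma mem_sliceLeft {I : TwoSidedIdeal (R × S)} {x : R} : x ∈ I.sliceLeft ↔ (x, 0) ∈ I :=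
  mem_mk' ..

@[simp]
lemma mem_sliceRight {I : TwoSidedIdeal (R × S)} {y : S} : y ∈ I.sliceRight ↔ (0, y) ∈ I :=
  mem_mk' ..

end NonUnitalNonAssocRing

section NonAssocRing

variable {R S : Type*} [NonUnitalNonAssocRing R] [NonAssocRing S] (I : TwoSidedIdeal (R × S))

/-- If the second factor is unital, membership in a two-sided ideal of a direct product can be
checked one coordinate at a time. -/
lemma prod_mem_iff {x : R} {y : S} : (x, y) ∈ I ↔ (x, 0) ∈ I ∧ (0, y) ∈ I := by
  refine ⟨fun h => ?_, fun ⟨hx, hy⟩ => by simpa using I.add_mem hx hy⟩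
  have hy : (0, y) ∈ I := by simpa using I.mul_mem_left (0, 1) _ h
  exact ⟨by simpa using I.sub_mem h hy, hy⟩

lemma isDirectlyDecomposable : IsDirectlyDecomposable I :=
  ⟨I.sliceLeft, I.sliceRight, fun p => by simpa using I.prod_mem_iff (x := p.1) (y := p.2)⟩

end NonAssocRing

end TwoSidedIdeal

theorem directlyDecomposable_of_field_factor
    {R F : Type*} [NonUnitalRing R] [Field F] (I : TwoSidedIdeal (R × F)) :
    IsDirectlyDecomposable I ∧
      ((∀ p : R × F, p ∈ I ↔ (∃ y : F, (p.1, y) ∈ I) ∧ p.2 = 0) ∨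
        (∀ p : R × F, p ∈ I ↔ ∃ y : F, (p.1, y) ∈ I)) := by
  refine ⟨I.isDirectlyDecomposable, ?_⟩
  by_cases h : ∀ c : F, (0, c) ∈ I → c = 0
  · left
    rintro ⟨x, y⟩
    refine ⟨fun hp => ⟨⟨y, hp⟩, h y (I.prod_mem_iff.1 hp).2⟩, ?_⟩
    rintro ⟨⟨z, hz⟩, rfl : y = 0⟩
    exact (I.prod_mem_iff.1 hz).1
  · right
    push Not at h
    obtain ⟨c, hc, hc0⟩ := h
    rintro ⟨x, y⟩
    refine ⟨fun hp => ⟨y, hp⟩, fun ⟨z, hz⟩ => I.prod_mem_iff.2 ⟨(I.prod_mem_iff.1 hz).1, ?_⟩⟩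
    simpa [hc0] using I.mul_mem_left (0, y * c⁻¹) _ hc
end

section
/- Let K be a non-unital commutative ring with zero multiplication (x·y = 0 for all x, y ∈ K) whose additive group has exponent 2 (x + x = 0 for all x ∈ K), and let a, c ∈ K with a ≠ 0 and c ≠ 0. Then the two-sided ideal of K × K generated by the element (a,c) equals {(0,0), (a,c)} and is skew, i.e., not directly decomposable; in particular (a,0) does not belong to it. (This applies for instance when K is the zero-ring on the Kleinian four-element group.) -/
open Pointwise

/-- In a ring with zero multiplication and additive exponent two, the two-sided ideal generated
by `r` is `{0, r}`. -/
theorem TwoSidedIdeal.mem_span_singleton_iff_of_mul_eq_zero {R : Type*} [NonUnitalNonAssocRing R]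
    (hmul : ∀ x y : R, x * y = 0) (hexp : ∀ x : R, x + x = 0) {r p : R} :
    p ∈ TwoSidedIdeal.span {r} ↔ p = 0 ∨ p = r := by
  constructor
  · intro hp
    induction hp using TwoSidedIdeal.span_induction with
    | mem x hx => exact Or.inr hx
    | zero => exact Or.inl rfl
    | add x y _ _ hx hy => rcases hx with rfl | rfl <;> rcases hy with rfl | rfl <;> simp [hexp]
    | neg x _ hx => rwa [neg_eq_of_add_eq_zero_left (hexp x)]
    | left_absorb a x _ _ => exact Or.inl (hmul _ _)
    | right_absorb b x _ _ => exact Or.inl (hmul _ _)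
  · rintro (rfl | rfl)
    · exact TwoSidedIdeal.zero_mem _
    · exact TwoSidedIdeal.subset_span rfl

theorem zeroRing_span_skew {K : Type*} [NonUnitalCommRing K]
    (hmul : ∀ x y : K, x * y = 0) (hexp : ∀ x : K, x + x = 0)
    (a c : K) (ha : a ≠ 0) (hc : c ≠ 0) :
    (∀ p : K × K, p ∈ TwoSidedIdeal.span {((a, c) : K × K)} ↔ p = 0 ∨ p = (a, c)) ∧
      ((a, (0 : K)) : K × K) ∉ TwoSidedIdeal.span {((a, c) : K × K)} ∧
      ¬ IsDirectlyDecomposable (TwoSidedIdeal.span {((a, c) : K × K)}) := by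
  have hspan (p : K × K) : p ∈ TwoSidedIdeal.span {((a, c) : K × K)} ↔ p = 0 ∨ p = (a, c) :=
    TwoSidedIdeal.mem_span_singleton_iff_of_mul_eq_zero
      (fun x y => Prod.ext (hmul _ _) (hmul _ _)) (fun x => Prod.ext (hexp _) (hexp _))
  have hnot : ((a, (0 : K)) : K × K) ∉ TwoSidedIdeal.span {((a, c) : K × K)} := by
    simp [hspan, ha, hc.symm]
  refine ⟨hspan, hnot, ?_⟩
  rintro ⟨I₁, I₂, hI⟩
  exact hnot ((hI _).2 ⟨((hI (a, c)).1 ((hspan _).2 (Or.inr rfl))).1, I₂.zero_mem⟩)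
end
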